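/- Let ν and μ be real numbers with ν > |μ| − 1 and let α > 0 be real. Then the limit as r → +∞ of ∫₀^∞ t^ν e^{−(t/r)^α} J_μ(t) dt exists and equals (2^ν/π) Γ((ν−μ+1)/2) Γ((ν+μ+1)/2) cos(π(ν−μ)/2). -/

import Mathlib

open MeasureTheory Filter

/-- The Bessel function of the first kind of order `μ`, defined by its power series. -/
noncomputable def besselJ (μ t : ℝ) : ℝ :=
  ∑' n : ℕ, ((-1 : ℝ) ^ n / ((n.factorial : ℝ) * Real.Gamma ((n : ℝ) + μ + 1))) *
    (t / 2) ^ (2 * (n : ℝ) + μ)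

/-- The coefficients of the power series of `besselEntire`. -/
noncomputable def besselCoeff (μ : ℝ) (n : ℕ) : ℝ :=
  (-1 : ℝ) ^ n / ((n.factorial : ℝ) * Real.Gamma ((n : ℝ) + μ + 1))

/-- The entire function `g_μ` with `J_μ(t) = (t/2)^μ g_μ(t²/4)`. -/
noncomputable def besselEntire (μ x : ℝ) : ℝ := ∑' n : ℕ, besselCoeff μ n * x ^ n

lemma exists_abs_inv_Gamma_le (μ : ℝ) :
    ∃ C, 0 ≤ C ∧ ∀ n : ℕ, |(Real.Gamma ((n : ℝ) + μ + 1))⁻¹| ≤ C := by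
  obtain ⟨N, hN⟩ := exists_nat_ge (1 - μ)
  have hsum : ∀ n ∈ Finset.range N, |(Real.Gamma ((n : ℝ) + μ + 1))⁻¹| ≤
      ∑ k ∈ Finset.range N, |(Real.Gamma ((k : ℝ) + μ + 1))⁻¹| := fun n hn =>
    Finset.single_le_sum (f := fun k : ℕ => |(Real.Gamma ((k : ℝ) + μ + 1))⁻¹|)
      (fun _ _ => abs_nonneg _) hn
  have hpos : 0 ≤ ∑ k ∈ Finset.range N, |(Real.Gamma ((k : ℝ) + μ + 1))⁻¹| :=
    Finset.sum_nonneg fun _ _ => abs_nonneg _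
  refine ⟨1 + ∑ k ∈ Finset.range N, |(Real.Gamma ((k : ℝ) + μ + 1))⁻¹|, by linarith, fun n => ?_⟩
  by_cases hn : n < N
  · linarith [hsum n (Finset.mem_range.mpr hn)]
  · have hnN : (N : ℝ) ≤ n := by exact_mod_cast not_lt.mp hn
    have h2 : (2 : ℝ) ≤ n + μ + 1 := by linarith
    have h1 : 1 ≤ Real.Gamma ((n : ℝ) + μ + 1) := by
      have := Real.Gamma_strictMonoOn_Ici.monotoneOn (Set.mem_Ici.mpr le_rfl) h2 h2
      rwa [Real.Gamma_two] at this
    rw [abs_of_nonneg (inv_nonneg.mpr (by linarith))]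
    linarith [inv_le_one_of_one_le₀ h1]

lemma exists_abs_besselCoeff_le (μ : ℝ) :
    ∃ C, 0 ≤ C ∧ ∀ n : ℕ, |besselCoeff μ n| ≤ C / n.factorial := by
  obtain ⟨C, hC, h⟩ := exists_abs_inv_Gamma_le μ
  refine ⟨C, hC, fun n => ?_⟩
  have : besselCoeff μ n = (-1) ^ n * (Real.Gamma ((n : ℝ) + μ + 1))⁻¹ / n.factorial := by
    unfold besselCoeff; rw [div_mul_eq_div_div, div_eq_mul_inv, div_mul_eq_mul_div]
  rw [this, abs_div, abs_mul, abs_pow, abs_neg, abs_one, one_pow, one_mul, Nat.abs_cast]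
  gcongr
  exact h n

lemma summable_abs_besselCoeff (μ x : ℝ) : Summable fun n : ℕ => |besselCoeff μ n * x ^ n| := by
  obtain ⟨C, hC, h⟩ := exists_abs_besselCoeff_le μ
  refine Summable.of_nonneg_of_le (fun _ => abs_nonneg _) (fun n => ?_)
    ((Real.summable_pow_div_factorial |x|).mul_left C)
  rw [abs_mul, abs_pow]
  calc _ ≤ C / n.factorial * |x| ^ n := by gcongr; exact h n
    _ = _ := by ring

lemma hasSum_besselEntire (μ x : ℝ) :
    HasSum (fun n : ℕ => besselCoeff μ n * x ^ n) (besselEntire μ x) :=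
  (summable_abs_besselCoeff μ x).of_abs.hasSum

lemma succ_mul_besselCoeff_succ (μ : ℝ) (n : ℕ) :
    (n + 1 : ℝ) * besselCoeff μ (n + 1) = -besselCoeff (μ + 1) n := by
  unfold besselCoeff
  have h1 : ((n + 1 : ℕ) : ℝ) + μ + 1 = n + (μ + 1) + 1 := by push_cast; ring
  have h2 : (n + 1 : ℝ) ≠ 0 := by positivity
  rw [h1, Nat.factorial_succ, pow_succ]
  push_cast
  rw [mul_assoc, mul_div_assoc', mul_div_mul_left _ _ h2]
  ring

lemma add_mul_besselCoeff_add_one (μ : ℝ) (n : ℕ) :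
    (n + μ + 1 : ℝ) * besselCoeff (μ + 1) n = besselCoeff μ n := by
  unfold besselCoeff
  rcases eq_or_ne ((n : ℝ) + μ + 1) 0 with h | h
  · rw [h]; simp
  · rw [show (n : ℝ) + (μ + 1) + 1 = (n + μ + 1) + 1 by ring, Real.Gamma_add_one h,
      mul_left_comm, mul_div_assoc', mul_div_mul_left _ _ h]

lemma hasDerivAt_besselEntire (μ x : ℝ) :
    HasDerivAt (besselEntire μ) (-besselEntire (μ + 1) x) x := by
  set R := |x| + 1 with hR
  have hR0 : 0 < R := by positivity
  have hmaj : Summable fun n : ℕ => |besselCoeff μ n| * (n * R ^ (n - 1)) := by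
    rw [← summable_nat_add_iff 1]
    refine (summable_abs_besselCoeff (μ + 1) R).congr fun n => ?_
    have := congrArg abs (succ_mul_besselCoeff_succ μ n)
    rw [abs_neg, abs_mul, abs_of_nonneg (by positivity : (0 : ℝ) ≤ n + 1)] at this
    rw [abs_mul, ← this, abs_of_nonneg (by positivity : (0 : ℝ) ≤ R ^ n)]
    push_cast
    ring
  have hderiv := hasDerivAt_tsum_of_isPreconnected (t := Metric.ball (0 : ℝ) R)
    (g := fun (n : ℕ) (y : ℝ) => besselCoeff μ n * y ^ n)
    (g' := fun (n : ℕ) (y : ℝ) => besselCoeff μ n * (n * y ^ (n - 1)))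
    hmaj Metric.isOpen_ball (convex_ball 0 R).isPreconnected
    (fun n y _ => (hasDerivAt_pow n y).const_mul _)
    (fun n y hy => by
      have : |y| ≤ R := by simpa using (Metric.mem_ball.mp hy).le
      simp only [norm_mul, Real.norm_eq_abs, abs_pow, Nat.abs_cast]
      gcongr)
    (Metric.mem_ball_self hR0) (summable_abs_besselCoeff μ 0).of_abs
    (y := x) (by simp [hR])
  refine hderiv.congr_deriv ?_
  have hs : Summable fun n : ℕ => besselCoeff μ n * (n * x ^ (n - 1)) := by
    refine Summable.of_norm_bounded hmaj fun n => ?_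
    simp only [norm_mul, Real.norm_eq_abs, abs_pow, Nat.abs_cast]
    gcongr
    linarith
  rw [hs.tsum_eq_zero_add]
  simp only [Nat.cast_zero, zero_mul, mul_zero, zero_add]
  unfold besselEntire
  rw [← tsum_neg]
  refine tsum_congr fun n => ?_
  rw [← neg_mul, ← succ_mul_besselCoeff_succ]
  push_cast
  ring

lemma besselEntire_recurrence (μ x : ℝ) :
    besselEntire μ x = (μ + 1) * besselEntire (μ + 1) x - x * besselEntire (μ + 2) x := by
  have h1 : HasSum (fun n : ℕ => n * besselCoeff (μ + 1) n * x ^ n)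
      (-(x * besselEntire (μ + 2) x)) := by
    rw [← hasSum_nat_add_iff' 1]
    simp only [Finset.range_one, Finset.sum_singleton, Nat.cast_zero, zero_mul, sub_zero]
    refine ((hasSum_besselEntire (μ + 2) x).mul_left x).neg.congr_fun ?_
    intro n
    have := succ_mul_besselCoeff_succ (μ + 1) n
    rw [show μ + 1 + 1 = μ + 2 by ring] at this
    push_cast
    rw [this]
    ring
  have h2 := ((hasSum_besselEntire (μ + 1) x).mul_left (μ + 1)).add h1
  refine (hasSum_besselEntire μ x).unique (h2.congr_fun ?_) |>.trans (by ring)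
  intro n
  rw [← add_mul_besselCoeff_add_one]
  ring

lemma continuous_besselEntire (μ : ℝ) : Continuous (besselEntire μ) :=
  continuous_iff_continuousAt.mpr fun x => (hasDerivAt_besselEntire μ x).continuousAt

lemma besselJ_eq (μ : ℝ) {t : ℝ} (ht : 0 < t) :
    besselJ μ t = (t / 2) ^ μ * besselEntire μ (t ^ 2 / 4) := by
  unfold besselJ besselEntire
  rw [← tsum_mul_left]
  refine tsum_congr fun n => ?_
  rw [Real.rpow_add (by positivity), Real.rpow_mul (by positivity), Real.rpow_natCast,
    show (2 : ℝ) = ((2 : ℕ) : ℝ) by norm_num, Real.rpow_natCast]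
  unfold besselCoeff
  rw [show t ^ 2 / 4 = (t / (2 : ℕ)) ^ 2 by push_cast; ring]
  ring

lemma hasDerivAt_besselJ (μ : ℝ) {t : ℝ} (ht : 0 < t) :
    HasDerivAt (besselJ μ) (μ / t * besselJ μ t - besselJ (μ + 1) t) t := by
  have hev : besselJ μ =ᶠ[nhds t] fun t => (t / 2) ^ μ * besselEntire μ (t ^ 2 / 4) := by
    filter_upwards [lt_mem_nhds ht] with s hs using besselJ_eq μ hs
  have h1 : HasDerivAt (fun s : ℝ => (s / 2) ^ μ) (1 / 2 * μ * (t / 2) ^ (μ - 1)) t :=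
    ((hasDerivAt_id t).div_const 2).rpow_const (Or.inl (by simp; positivity))
  have h2 : HasDerivAt (fun s : ℝ => besselEntire μ (s ^ 2 / 4))
      (-besselEntire (μ + 1) (t ^ 2 / 4) * (2 * t / 4)) t := by
    have h3 : HasDerivAt (fun s : ℝ => s ^ 2 / 4) (2 * t / 4) t := by
      simpa using (hasDerivAt_pow 2 t).div_const 4
    exact (hasDerivAt_besselEntire μ _).comp t h3
  refine ((h1.mul h2).congr_of_eventuallyEq hev).congr_deriv ?_
  rw [besselJ_eq _ ht, besselJ_eq _ ht, Real.rpow_add_one (by positivity),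
    Real.rpow_sub_one (by positivity)]
  field_simp
  ring

lemma besselJ_recurrence (μ : ℝ) {t : ℝ} (ht : 0 < t) :
    besselJ μ t = 2 * (μ + 1) / t * besselJ (μ + 1) t - besselJ (μ + 2) t := by
  rw [besselJ_eq _ ht, besselJ_eq _ ht, besselJ_eq _ ht, besselEntire_recurrence μ,
    Real.rpow_add_one (by positivity), Real.rpow_add (by positivity), Real.rpow_two]
  field_simp
  ring

lemma hasDerivAt_besselJ_add_one (μ : ℝ) {t : ℝ} (ht : 0 < t) :
    HasDerivAt (besselJ (μ + 1)) (besselJ μ t - (μ + 1) / t * besselJ (μ + 1) t) t := by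
  refine (hasDerivAt_besselJ (μ + 1) ht).congr_deriv ?_
  rw [besselJ_recurrence μ ht, show μ + 1 + 1 = μ + 2 by ring]
  ring

lemma hasDerivAt_rpow_mul_besselJ (μ : ℝ) {t : ℝ} (ht : 0 < t) :
    HasDerivAt (fun s => s ^ (μ + 1) * besselJ (μ + 1) s) (t ^ (μ + 1) * besselJ μ t) t := by
  refine ((Real.hasDerivAt_rpow_const (p := μ + 1) (Or.inl ht.ne')).mul
    (hasDerivAt_besselJ_add_one μ ht)).congr_deriv ?_
  rw [Real.rpow_sub_one ht.ne']
  ring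

lemma continuousOn_besselJ (μ : ℝ) : ContinuousOn (besselJ μ) (Set.Ioi 0) := fun _ ht =>
  (hasDerivAt_besselJ μ (Set.mem_Ioi.mp ht)).continuousAt.continuousWithinAt

lemma exists_abs_besselJ_le_rpow (μ T : ℝ) :
    ∃ M, 0 ≤ M ∧ ∀ t, 0 < t → t ≤ T → |besselJ μ t| ≤ M * t ^ μ := by
  obtain ⟨C, hC⟩ := isCompact_Icc.exists_bound_of_continuousOn (s := Set.Icc 0 (T ^ 2 / 4))
    (continuous_besselEntire μ).continuousOn
  refine ⟨|C| / 2 ^ μ, by positivity, fun t ht htT => ?_⟩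
  have hg : |besselEntire μ (t ^ 2 / 4)| ≤ |C| :=
    (hC _ ⟨by positivity, by gcongr⟩).trans (le_abs_self C)
  rw [besselJ_eq μ ht, abs_mul, abs_of_pos (by positivity), Real.div_rpow ht.le two_pos.le]
  calc t ^ μ / 2 ^ μ * |besselEntire μ (t ^ 2 / 4)| ≤ t ^ μ / 2 ^ μ * |C| := by gcongr
    _ = _ := by ring

lemma hasDerivAt_besselJ_energy (μ : ℝ) {t : ℝ} (ht : |μ| < t) :
    HasDerivAt (fun s => besselJ μ s ^ 2 +
        (μ * besselJ μ s - s * besselJ (μ + 1) s) ^ 2 / (s ^ 2 - μ ^ 2))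
      (-(2 * t * (μ * besselJ μ t - t * besselJ (μ + 1) t) ^ 2 / (t ^ 2 - μ ^ 2) ^ 2)) t := by
  have ht0 : 0 < t := (abs_nonneg μ).trans_lt ht
  have hne : t ^ 2 - μ ^ 2 ≠ 0 := by
    have := sq_lt_sq.mpr (ht.trans_le (le_abs_self t))
    linarith
  have hu := hasDerivAt_besselJ μ ht0
  have hv := hasDerivAt_besselJ_add_one μ ht0
  have hw := (hu.const_mul μ).sub ((hasDerivAt_id t).mul hv)
  have hq := (hasDerivAt_pow 2 t).sub_const (μ ^ 2)
  refine ((hu.pow 2).add ((hw.pow 2).div hq hne)).congr_deriv ?_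
  simp only [id, Pi.sub_apply, Pi.mul_apply, Pi.pow_apply]
  field_simp
  ring

lemma exists_abs_besselJ_le (μ : ℝ) : ∃ M, 0 ≤ M ∧ ∀ t, |μ| + 1 ≤ t → |besselJ μ t| ≤ M := by
  set E : ℝ → ℝ := fun s => besselJ μ s ^ 2 +
    (μ * besselJ μ s - s * besselJ (μ + 1) s) ^ 2 / (s ^ 2 - μ ^ 2) with hE
  have hd : ∀ t ∈ Set.Ici (|μ| + 1), HasDerivAt E _ t := fun t ht =>
    hasDerivAt_besselJ_energy μ (t := t) (by linarith [Set.mem_Ici.mp ht])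
  have hanti : AntitoneOn E (Set.Ici (|μ| + 1)) := by
    refine antitoneOn_of_deriv_nonpos (convex_Ici _)
      (fun t ht => (hd t ht).continuousAt.continuousWithinAt)
      (fun t ht => (hd t (interior_subset ht)).differentiableAt.differentiableWithinAt)
      fun t ht => ?_
    have ht' := interior_subset ht
    have ht0 : 0 ≤ t := by linarith [Set.mem_Ici.mp ht', abs_nonneg μ]
    rw [(hd t ht').deriv, neg_nonpos]
    positivity
  refine ⟨√(E (|μ| + 1)), Real.sqrt_nonneg _, fun t ht => Real.abs_le_sqrt ?_⟩
  have hpos : 0 ≤ t ^ 2 - μ ^ 2 := by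
    have := sq_le_sq.mpr ((by linarith : |μ| ≤ t).trans (le_abs_self t))
    linarith
  have := hanti Set.self_mem_Ici ht ht
  refine le_trans ?_ this
  simp only [hE]
  have : 0 ≤ (μ * besselJ μ t - t * besselJ (μ + 1) t) ^ 2 / (t ^ 2 - μ ^ 2) := by positivity
  linarith

lemma integrableOn_mul_besselJ {f : ℝ → ℝ} {μ a b A B : ℝ}
    (hf : ContinuousOn f (Set.Ioi 0)) (ha : -1 < a + μ) (hb : b < -1)
    (hfa : ∀ t, 0 < t → |f t| ≤ A * t ^ a) (hfb : ∀ t, 0 < t → |f t| ≤ B * t ^ b) :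
    IntegrableOn (fun t => f t * besselJ μ t) (Set.Ioi 0) := by
  have hT : 0 < |μ| + 1 := by positivity
  obtain ⟨M, hM, h0⟩ := exists_abs_besselJ_le_rpow μ (|μ| + 1)
  obtain ⟨M', hM', hinf⟩ := exists_abs_besselJ_le μ
  have hcont : ContinuousOn (fun t => f t * besselJ μ t) (Set.Ioi 0) :=
    hf.mul (continuousOn_besselJ μ)
  rw [← Set.Ioc_union_Ioi_eq_Ioi hT.le]
  refine IntegrableOn.union ?_ ?_
  · have hi : IntegrableOn (fun t : ℝ => A * M * t ^ (a + μ)) (Set.Ioc 0 (|μ| + 1)) :=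
      ((intervalIntegrable_iff_integrableOn_Ioc_of_le hT.le).mp
        (intervalIntegral.intervalIntegrable_rpow' ha)).const_mul _
    refine hi.mono' ((hcont.mono Set.Ioc_subset_Ioi_self).aestronglyMeasurable measurableSet_Ioc)
      ((ae_restrict_mem measurableSet_Ioc).mono fun t ht => ?_)
    rw [Real.norm_eq_abs, abs_mul, Real.rpow_add ht.1]
    calc |f t| * |besselJ μ t| ≤ (A * t ^ a) * (M * t ^ μ) := by
          exact mul_le_mul (hfa t ht.1) (h0 t ht.1 ht.2) (abs_nonneg _)
            ((abs_nonneg _).trans (hfa t ht.1))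
      _ = _ := by ring
  · have hi : IntegrableOn (fun t : ℝ => B * M' * t ^ b) (Set.Ioi (|μ| + 1)) :=
      (integrableOn_Ioi_rpow_of_lt hb hT).const_mul _
    refine hi.mono' ((hcont.mono (Set.Ioi_subset_Ioi hT.le)).aestronglyMeasurable
      measurableSet_Ioi) ((ae_restrict_mem measurableSet_Ioi).mono fun t ht => ?_)
    have ht' : |μ| + 1 < t := ht
    have ht0 : 0 < t := hT.trans ht'
    rw [Real.norm_eq_abs, abs_mul]
    calc |f t| * |besselJ μ t| ≤ (B * t ^ b) * M' := by
          exact mul_le_mul (hfb t ht0) (hinf t ht'.le) (abs_nonneg _)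
            ((abs_nonneg _).trans (hfb t ht0))
      _ = _ := by ring

lemma integrableOn_rpow_mul_besselJ {ν μ : ℝ} (hν : ν < -1) (hνμ : -1 < ν + μ) :
    IntegrableOn (fun t => t ^ ν * besselJ μ t) (Set.Ioi 0) := by
  have hb : ∀ t : ℝ, 0 < t → |t ^ ν| ≤ 1 * t ^ ν := fun t ht => by
    rw [abs_of_pos (by positivity), one_mul]
  exact integrableOn_mul_besselJ
    (fun t ht => (Real.continuousAt_rpow_const t ν (Or.inl (ne_of_gt ht))).continuousWithinAt)
    hνμ hν hb hb

lemma pow_mul_exp_neg_le_factorial {x : ℝ} (hx : 0 ≤ x) (n : ℕ) :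
    x ^ n * Real.exp (-x) ≤ n.factorial := by
  have h := Real.pow_div_factorial_le_exp x hx n
  rw [div_le_iff₀ (by positivity)] at h
  rw [Real.exp_neg, ← div_eq_mul_inv, div_le_iff₀ (Real.exp_pos x)]
  linarith

lemma rpow_mul_exp_neg_le (ν : ℝ) {α c t : ℝ} (hc : 0 < c) (ht : 0 < t) (N : ℕ) :
    t ^ ν * Real.exp (-(c * t ^ α)) ≤ N.factorial / c ^ N * t ^ (ν - N * α) := by
  have h := pow_mul_exp_neg_le_factorial (x := c * t ^ α) (by positivity) N
  rw [Real.rpow_sub ht, mul_comm (N : ℝ) α, Real.rpow_mul ht.le, Real.rpow_natCast,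
    div_mul_div_comm, le_div_iff₀ (by positivity)]
  rw [mul_pow] at h
  calc _ = t ^ ν * (c ^ N * (t ^ α) ^ N * Real.exp (-(c * t ^ α))) := by ring
    _ ≤ t ^ ν * N.factorial := by gcongr
    _ = _ := by ring

lemma continuousOn_rpow_mul_exp_neg (ν α c : ℝ) :
    ContinuousOn (fun t : ℝ => t ^ ν * Real.exp (-(c * t ^ α))) (Set.Ioi 0) := by
  have h : ∀ s : ℝ, ContinuousOn (fun t : ℝ => t ^ s) (Set.Ioi 0) := fun s t ht =>
    (Real.continuousAt_rpow_const t s (Or.inl (ne_of_gt ht))).continuousWithinAt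
  exact (h ν).mul (Real.continuous_exp.comp_continuousOn ((h α).const_mul c).neg)

lemma rpow_mul_exp_neg_le_rpow (ν : ℝ) {α c t : ℝ} (hc : 0 < c) (ht : 0 < t) :
    t ^ ν * Real.exp (-(c * t ^ α)) ≤ t ^ ν := by
  simpa using rpow_mul_exp_neg_le ν (α := α) hc ht 0

lemma integrableOn_rpow_mul_exp_neg_mul_besselJ {ν μ α c : ℝ} (hνμ : -1 < ν + μ) (hα : 0 < α)
    (hc : 0 < c) :
    IntegrableOn (fun t => t ^ ν * Real.exp (-(c * t ^ α)) * besselJ μ t) (Set.Ioi 0) := by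
  obtain ⟨N, hN⟩ := exists_nat_gt ((ν + 1) / α)
  rw [div_lt_iff₀ hα] at hN
  refine integrableOn_mul_besselJ (continuousOn_rpow_mul_exp_neg ν α c) hνμ
    (A := 1) (B := N.factorial / c ^ N) (b := ν - N * α) (by linarith) (fun t ht => ?_)
    (fun t ht => ?_)
  · rw [abs_of_pos (by positivity), one_mul]
    exact rpow_mul_exp_neg_le_rpow ν hc ht
  · rw [abs_of_pos (by positivity)]
    exact rpow_mul_exp_neg_le ν hc ht N

lemma integral_rpow_mul_exp_neg_mul_sq {q p : ℝ} (hq : -1 < q) (hp : 0 < p) :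
    IntegrableOn (fun t : ℝ => t ^ q * Real.exp (-(t ^ 2 * p))) (Set.Ioi 0) ∧
      ∫ t in Set.Ioi (0 : ℝ), t ^ q * Real.exp (-(t ^ 2 * p)) =
        p ^ (-((q + 1) / 2)) / 2 * Real.Gamma ((q + 1) / 2) := by
  have h1 := integrableOn_rpow_mul_exp_neg_mul_rpow hq two_pos hp
  have h2 := integral_rpow_mul_exp_neg_mul_rpow two_pos hq hp
  have heq : ∀ t : ℝ, t ^ q * Real.exp (-p * t ^ (2 : ℝ)) = t ^ q * Real.exp (-(t ^ 2 * p)) :=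
    fun t => by rw [Real.rpow_two]; ring_nf
  simp only [heq] at h1 h2
  refine ⟨h1, h2.trans ?_⟩
  rw [neg_div]
  ring

lemma integral_exp_neg_mul_sq_mul_besselJ {μ p : ℝ} (hμ : -1 < μ) (hp : 0 < p) :
    ∫ t in Set.Ioi (0 : ℝ), t ^ (μ + 1) * Real.exp (-(t ^ 2 * p)) * besselJ μ t =
      (2 * p) ^ (-(μ + 1)) * Real.exp (-(1 / 4 * p⁻¹)) := by
  set F : ℕ → ℝ → ℝ := fun n t => besselCoeff μ n / (2 ^ μ * 4 ^ n) *
    (t ^ (2 * n + 2 * μ + 1) * Real.exp (-(t ^ 2 * p))) with hF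
  have hbase : ∀ n : ℕ, _ := fun n => integral_rpow_mul_exp_neg_mul_sq (p := p)
    (q := 2 * n + 2 * μ + 1) (by have : (0 : ℝ) ≤ n := n.cast_nonneg; linarith) hp
  have hval : ∀ n : ℕ, ∫ t in Set.Ioi (0 : ℝ), F n t =
      (2 * p) ^ (-(μ + 1)) * ((-(1 / 4 * p⁻¹)) ^ n / n.factorial) := fun n => by
    have hG : Real.Gamma (n + μ + 1) ≠ 0 :=
      (Real.Gamma_pos_of_pos (by have : (0 : ℝ) ≤ n := n.cast_nonneg; linarith)).ne'
    rw [integral_const_mul, (hbase n).2,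
      show ((2 * n + 2 * μ + 1 + 1) / 2 : ℝ) = n + μ + 1 by ring, besselCoeff,
      Real.mul_rpow two_pos.le hp.le, show (-(n + μ + 1) : ℝ) = -(μ + 1) - n by ring,
      Real.rpow_sub_natCast hp.ne', Real.rpow_neg two_pos.le, Real.rpow_add_one two_ne_zero,
      show -(1 / 4 * p⁻¹) = -1 / (4 * p) by field_simp, div_pow, mul_pow]
    field_simp
  have hint : ∀ n, Integrable (F n) (volume.restrict (Set.Ioi 0)) := fun n =>
    (hbase n).1.const_mul _
  have hnorm : ∀ n : ℕ, ∫ t in Set.Ioi (0 : ℝ), ‖F n t‖ = |∫ t in Set.Ioi (0 : ℝ), F n t| := by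
    intro n
    have hnn : 0 ≤ ∫ t in Set.Ioi (0 : ℝ),
        t ^ (2 * n + 2 * μ + 1) * Real.exp (-(t ^ 2 * p)) :=
      setIntegral_nonneg measurableSet_Ioi fun t (ht : 0 < t) => by positivity
    simp only [hF]
    rw [integral_const_mul, abs_mul, abs_of_nonneg hnn, ← integral_const_mul]
    refine setIntegral_congr_fun measurableSet_Ioi fun t (ht : 0 < t) => ?_
    simp only [norm_mul, Real.norm_eq_abs]
    rw [abs_of_pos (by positivity : 0 < t ^ (2 * n + 2 * μ + 1)), abs_of_pos (Real.exp_pos _)]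
  have hexp : HasSum (fun n : ℕ => (2 * p) ^ (-(μ + 1)) * ((-(1 / 4 * p⁻¹)) ^ n / n.factorial))
      ((2 * p) ^ (-(μ + 1)) * Real.exp (-(1 / 4 * p⁻¹))) := by
    rw [Real.exp_eq_exp_ℝ]
    have := NormedSpace.expSeries_div_hasSum_exp (-(1 / 4 * p⁻¹))
    exact this.mul_left ((2 * p) ^ (-(μ + 1)))
  have hsum := hasSum_integral_of_summable_integral_norm hint (by
    simp only [hnorm, hval]
    exact hexp.summable.abs)
  simp only [hval] at hsum
  rw [← hsum.unique hexp]
  refine setIntegral_congr_fun measurableSet_Ioi fun t (ht : 0 < t) => ?_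
  simp only [hF]
  rw [besselJ_eq μ ht, besselEntire, ← tsum_mul_left, ← tsum_mul_left]
  refine tsum_congr fun n => ?_
  rw [show (2 * n + 2 * μ + 1 : ℝ) = (μ + 1) + μ + (2 * n : ℕ) by push_cast; ring,
    Real.rpow_add_natCast ht.ne', Real.rpow_add ht (μ + 1) μ, Real.div_rpow ht.le two_pos.le, div_pow,
    pow_mul]
  field_simp

lemma integral_rpow_mul_besselJ {ν μ : ℝ} (hν : ν < -1) (hνμ : -1 < ν + μ) :
    ∫ t in Set.Ioi (0 : ℝ), t ^ ν * besselJ μ t =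
      2 ^ ν * Real.Gamma ((ν + μ + 1) / 2) / Real.Gamma ((μ + 1 - ν) / 2) := by
  set b := (μ + 1 - ν) / 2 with hb
  have hb0 : 0 < b := by rw [hb]; linarith
  have hGb : 0 < Real.Gamma b := Real.Gamma_pos_of_pos hb0
  set G : ℝ → ℝ → ℝ := fun t p =>
    t ^ (μ + 1) * besselJ μ t * (p ^ (b - 1) * Real.exp (-(t ^ 2 * p))) with hG
  have hinner : ∀ t : ℝ, 0 < t → t ^ (μ + 1) * ((1 / t ^ 2) ^ b * Real.Gamma b) =
      Real.Gamma b * t ^ ν := fun t ht => by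
    rw [one_div, Real.inv_rpow (by positivity), ← Real.rpow_natCast t 2, ← Real.rpow_mul ht.le,
      ← Real.rpow_neg ht.le, ← mul_assoc, ← Real.rpow_add ht, mul_comm]
    congr 2
    push_cast
    rw [hb]; ring
  have hp_int : ∀ t : ℝ, 0 < t → ∫ p in Set.Ioi (0 : ℝ), G t p =
      Real.Gamma b * (t ^ ν * besselJ μ t) := fun t ht => by
    simp only [hG]
    rw [integral_const_mul, Real.integral_rpow_mul_exp_neg_mul_Ioi hb0 (by positivity),
      mul_right_comm, hinner t ht, mul_assoc]
  have hp_norm : ∀ t : ℝ, 0 < t → ∫ p in Set.Ioi (0 : ℝ), ‖G t p‖ =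
      Real.Gamma b * |t ^ ν * besselJ μ t| := fun t ht => by
    have : ∫ p in Set.Ioi (0 : ℝ), ‖G t p‖ = ∫ p in Set.Ioi (0 : ℝ),
        t ^ (μ + 1) * |besselJ μ t| * (p ^ (b - 1) * Real.exp (-(t ^ 2 * p))) := by
      refine setIntegral_congr_fun measurableSet_Ioi fun p (hp : 0 < p) => ?_
      simp only [hG, norm_mul, Real.norm_eq_abs]
      rw [abs_of_pos (by positivity : 0 < t ^ (μ + 1)),
        abs_of_pos (by positivity : 0 < p ^ (b - 1)), abs_of_pos (Real.exp_pos _)]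
    rw [this, integral_const_mul, Real.integral_rpow_mul_exp_neg_mul_Ioi hb0 (by positivity),
      mul_right_comm, hinner t ht, mul_assoc, abs_mul, abs_of_pos (by positivity : 0 < t ^ ν)]
  have hrpow : ∀ s : ℝ, ContinuousOn (fun t : ℝ => t ^ s) (Set.Ioi 0) := fun s t ht =>
    (Real.continuousAt_rpow_const t s (Or.inl (ne_of_gt ht))).continuousWithinAt
  have hcont : ContinuousOn (Function.uncurry G) (Set.Ioi 0 ×ˢ Set.Ioi 0) := by
    have h1 : Set.MapsTo Prod.fst (Set.Ioi (0 : ℝ) ×ˢ Set.Ioi (0 : ℝ)) (Set.Ioi 0) :=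
      fun x hx => hx.1
    have h2 : Set.MapsTo Prod.snd (Set.Ioi (0 : ℝ) ×ˢ Set.Ioi (0 : ℝ)) (Set.Ioi 0) :=
      fun x hx => hx.2
    exact (((hrpow _).comp continuousOn_fst h1).mul
      ((continuousOn_besselJ μ).comp continuousOn_fst h1)).mul
      (((hrpow _).comp continuousOn_snd h2).mul (by fun_prop))
  have hGint : Integrable (Function.uncurry G)
      ((volume.restrict (Set.Ioi 0)).prod (volume.restrict (Set.Ioi 0))) := by
    rw [integrable_prod_iff]
    · refine ⟨(ae_restrict_mem measurableSet_Ioi).mono fun t (ht : 0 < t) => ?_, ?_⟩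
      · have : IntegrableOn (fun p : ℝ => p ^ (b - 1) * Real.exp (-(t ^ 2 * p))) (Set.Ioi 0) :=
          .of_integral_ne_zero (by
            rw [Real.integral_rpow_mul_exp_neg_mul_Ioi hb0 (by positivity)]; positivity)
        exact Integrable.const_mul this (t ^ (μ + 1) * besselJ μ t)
      · refine ((integrableOn_rpow_mul_besselJ hν hνμ).abs.const_mul (Real.Gamma b)).congr ?_
        exact (ae_restrict_mem measurableSet_Ioi).mono fun t ht => (hp_norm t ht).symm
    · rw [Measure.prod_restrict]
      exact hcont.aestronglyMeasurable (measurableSet_Ioi.prod measurableSet_Ioi)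
  have hswap := integral_integral_swap hGint
  rw [setIntegral_congr_fun measurableSet_Ioi fun t ht => hp_int t ht, integral_const_mul]
    at hswap
  have hright : ∫ p in Set.Ioi (0 : ℝ), ∫ t in Set.Ioi (0 : ℝ), G t p =
      2 ^ ν * Real.Gamma ((ν + μ + 1) / 2) := by
    set a := (ν + μ + 1) / 2 with ha
    have ha0 : 0 < a := by rw [ha]; linarith
    have hsub := integral_comp_rpow_Ioi
      (fun y : ℝ => y ^ (a - 1) * Real.exp (-(1 / 4 * y))) (p := -1) (by norm_num)
    rw [Real.integral_rpow_mul_exp_neg_mul_Ioi ha0 (by norm_num)] at hsub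
    have h4 : (2 : ℝ) ^ ν * Real.Gamma a =
        2 ^ (-(μ + 1)) * ((1 / (1 / 4)) ^ a * Real.Gamma a) := by
      rw [← mul_assoc, show (1 / (1 / 4) : ℝ) = 2 ^ (2 : ℝ) by norm_num,
        ← Real.rpow_mul two_pos.le, ← Real.rpow_add two_pos]
      congr 2
      rw [ha]; ring
    rw [h4, ← hsub, ← integral_const_mul]
    refine setIntegral_congr_fun measurableSet_Ioi fun p (hp : 0 < p) => ?_
    have h5 : ∫ t in Set.Ioi (0 : ℝ), G t p = p ^ (b - 1) *
        ∫ t in Set.Ioi (0 : ℝ), t ^ (μ + 1) * Real.exp (-(t ^ 2 * p)) * besselJ μ t := by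
      rw [← integral_const_mul]
      exact integral_congr_ae (.of_forall fun t => by simp only [hG]; ring)
    rw [h5, integral_exp_neg_mul_sq_mul_besselJ (by linarith) hp,
      Real.mul_rpow two_pos.le hp.le, Real.rpow_neg_one, Real.inv_rpow hp.le,
      ← Real.rpow_neg hp.le]
    have h6 : p ^ (b - 1) * p ^ (-(μ + 1)) = p ^ (-1 - 1 : ℝ) * p ^ (-(a - 1)) := by
      rw [← Real.rpow_add hp, ← Real.rpow_add hp]
      congr 1
      rw [ha, hb]; ring
    simp only [abs_neg, abs_one, one_mul, smul_eq_mul]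
    linear_combination 2 ^ (-(μ + 1)) * Real.exp (-(1 / 4 * p⁻¹)) * h6
  rw [hright] at hswap
  rw [eq_div_iff hGb.ne', mul_comm]
  exact hswap

/-- The Abel-type regularisation `∫₀^∞ t^ν e^{-c t^α} J_μ(t) dt`. -/
noncomputable def besselAbel (α ν μ c : ℝ) : ℝ :=
  ∫ t in Set.Ioi (0 : ℝ), t ^ ν * Real.exp (-(c * t ^ α)) * besselJ μ t

lemma tendsto_rpow_mul_exp_neg_mul_besselJ_zero {ν μ α c : ℝ} (hνμ : 0 < ν + μ) (hc : 0 < c) :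
    Tendsto (fun t => t ^ ν * Real.exp (-(c * t ^ α)) * besselJ μ t)
      (nhdsWithin 0 (Set.Ioi 0)) (nhds 0) := by
  obtain ⟨M, hM, h0⟩ := exists_abs_besselJ_le_rpow μ 1
  have hlim : Tendsto (fun t : ℝ => M * t ^ (ν + μ)) (nhdsWithin 0 (Set.Ioi 0)) (nhds 0) := by
    have := ((Real.continuousAt_rpow_const 0 (ν + μ) (Or.inr hνμ.le)).tendsto.const_mul M)
    rw [Real.zero_rpow hνμ.ne', mul_zero] at this
    exact this.mono_left nhdsWithin_le_nhds
  refine squeeze_zero_norm' ?_ hlim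
  filter_upwards [Ioc_mem_nhdsGT (zero_lt_one (α := ℝ))] with t ht
  have ht0 := ht.1
  rw [Real.norm_eq_abs, abs_mul, abs_of_pos (by positivity), Real.rpow_add ht0]
  calc _ ≤ t ^ ν * (M * t ^ μ) :=
        mul_le_mul (rpow_mul_exp_neg_le_rpow ν hc ht0) (h0 t ht0 ht.2) (abs_nonneg _)
          (by positivity)
    _ = _ := by ring

lemma tendsto_rpow_mul_exp_neg_mul_besselJ_atTop (ν μ : ℝ) {α c : ℝ} (hα : 0 < α) (hc : 0 < c) :
    Tendsto (fun t => t ^ ν * Real.exp (-(c * t ^ α)) * besselJ μ t) atTop (nhds 0) := by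
  obtain ⟨M, hM, hinf⟩ := exists_abs_besselJ_le μ
  obtain ⟨N, hN⟩ := exists_nat_gt (ν / α)
  rw [div_lt_iff₀ hα] at hN
  have hlim : Tendsto (fun t : ℝ => N.factorial / c ^ N * t ^ (ν - N * α) * M) atTop (nhds 0) := by
    have := ((tendsto_rpow_neg_atTop (y := N * α - ν) (by linarith)).const_mul
      (N.factorial / c ^ N)).mul_const M
    simpa using this
  refine squeeze_zero_norm' ?_ hlim
  filter_upwards [eventually_gt_atTop 0, eventually_ge_atTop (|μ| + 1)] with t ht0 ht
  rw [Real.norm_eq_abs, abs_mul, abs_of_pos (by positivity)]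
  exact mul_le_mul (rpow_mul_exp_neg_le ν hc ht0 N) (hinf t ht) (abs_nonneg _) (by positivity)

lemma besselAbel_eq {α ν μ c : ℝ} (hα : 0 < α) (hνμ : -1 < ν + μ) (hc : 0 < c) :
    besselAbel α ν μ c = (μ + 1 - ν) * besselAbel α (ν - 1) (μ + 1) c +
      α * c * besselAbel α (ν - 1 + α) (μ + 1) c := by
  set u : ℝ → ℝ := fun t => t ^ (ν - μ - 1) * Real.exp (-(c * t ^ α)) with hu
  set u' : ℝ → ℝ := fun t => -((μ + 1 - ν) * (t ^ (ν - μ - 2) * Real.exp (-(c * t ^ α))) +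
    α * c * (t ^ (ν - μ - 2 + α) * Real.exp (-(c * t ^ α)))) with hu'
  set v : ℝ → ℝ := fun t => t ^ (μ + 1) * besselJ (μ + 1) t with hv
  set v' : ℝ → ℝ := fun t => t ^ (μ + 1) * besselJ μ t with hv'
  have hsplit : ∀ s t : ℝ, 0 < t → t ^ s * t ^ (μ + 1) = t ^ (s + μ + 1) := fun s t ht => by
    rw [← Real.rpow_add ht, add_assoc]
  have hdu : ∀ t ∈ Set.Ioi (0 : ℝ), HasDerivAt u (u' t) t := fun t (ht : 0 < t) => by
    have h1 := Real.hasDerivAt_rpow_const (p := ν - μ - 1) (Or.inl ht.ne')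
    have h2 := ((Real.hasDerivAt_rpow_const (p := α) (Or.inl ht.ne')).const_mul c).neg.exp
    refine (h1.mul h2).congr_deriv ?_
    simp only [hu', Pi.neg_apply]
    rw [show ν - μ - 2 + α = (ν - μ - 1) + (α - 1) by ring,
      Real.rpow_add ht, show ν - μ - 1 - 1 = ν - μ - 2 by ring]
    ring
  have huv' : ∀ t : ℝ, 0 < t → u t * v' t = t ^ ν * Real.exp (-(c * t ^ α)) * besselJ μ t :=
    fun t ht => by
      simp only [hu, hv']
      have := hsplit (ν - μ - 1) t ht
      rw [show ν - μ - 1 + μ + 1 = ν by ring] at this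
      rw [← this]
      ring
  have huv : ∀ t : ℝ, 0 < t → u t * v t =
      t ^ ν * Real.exp (-(c * t ^ α)) * besselJ (μ + 1) t := fun t ht => by
    simp only [hu, hv]
    have := hsplit (ν - μ - 1) t ht
    rw [show ν - μ - 1 + μ + 1 = ν by ring] at this
    rw [← this]
    ring
  have hu'v : ∀ t : ℝ, 0 < t → u' t * v t =
      -((μ + 1 - ν) * (t ^ (ν - 1) * Real.exp (-(c * t ^ α)) * besselJ (μ + 1) t) +
      α * c * (t ^ (ν - 1 + α) * Real.exp (-(c * t ^ α)) * besselJ (μ + 1) t)) := fun t ht => by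
    simp only [hu', hv]
    have h1 := hsplit (ν - μ - 2) t ht
    have h2 := hsplit (ν - μ - 2 + α) t ht
    rw [show ν - μ - 2 + μ + 1 = ν - 1 by ring] at h1
    rw [show ν - μ - 2 + α + μ + 1 = ν - 1 + α by ring] at h2
    rw [← h1, ← h2]
    ring
  have hi0 := integrableOn_rpow_mul_exp_neg_mul_besselJ hνμ hα hc
  have hi1 := integrableOn_rpow_mul_exp_neg_mul_besselJ
    (ν := ν - 1) (μ := μ + 1) (by linarith) hα hc
  have hi2 := integrableOn_rpow_mul_exp_neg_mul_besselJ
    (ν := ν - 1 + α) (μ := μ + 1) (by linarith) hα hc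
  have hiu'v : IntegrableOn (u' * v) (Set.Ioi 0) :=
    IntegrableOn.congr_fun (((hi1.const_mul (μ + 1 - ν)).add (hi2.const_mul (α * c))).neg)
      (fun t ht => (hu'v t ht).symm) measurableSet_Ioi
  have hibp := integral_Ioi_mul_deriv_eq_deriv_mul (a := (0 : ℝ)) (a' := 0) (b' := 0) hdu
    (fun t ht => hasDerivAt_rpow_mul_besselJ μ ht)
    (hi0.congr_fun (fun t ht => (huv' t ht).symm) measurableSet_Ioi)
    hiu'v
    ((tendsto_rpow_mul_exp_neg_mul_besselJ_zero (ν := ν) (μ := μ + 1) (α := α) (by linarith)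
      hc).congr' (eventually_mem_nhdsWithin.mono fun t ht => (huv t ht).symm))
    ((tendsto_rpow_mul_exp_neg_mul_besselJ_atTop ν (μ + 1) hα hc).congr'
      ((eventually_gt_atTop 0).mono fun t ht => (huv t ht).symm))
  rw [setIntegral_congr_fun measurableSet_Ioi huv', setIntegral_congr_fun measurableSet_Ioi hu'v,
    integral_neg, integral_add (hi1.const_mul _) (hi2.const_mul _), integral_const_mul,
    integral_const_mul] at hibp
  unfold besselAbel
  rw [hibp]
  ring

/-- The value of the regularised integral `∫₀^∞ t^ν J_μ(t) dt`. -/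
noncomputable def besselMoment (ν μ : ℝ) : ℝ :=
  2 ^ ν * Real.Gamma ((ν + μ + 1) / 2) / Real.Gamma ((μ + 1 - ν) / 2)

lemma besselMoment_eq (ν μ : ℝ) :
    besselMoment ν μ = (μ + 1 - ν) * besselMoment (ν - 1) (μ + 1) := by
  unfold besselMoment
  rw [show (ν - 1 + (μ + 1) + 1) / 2 = (ν + μ + 1) / 2 by ring,
    show (μ + 1 + 1 - (ν - 1)) / 2 = (μ + 1 - ν) / 2 + 1 by ring, Real.rpow_sub_one two_ne_zero]
  rcases eq_or_ne (μ + 1 - ν) 0 with h | h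
  · simp [h]
  · rw [Real.Gamma_add_one (by positivity)]
    field_simp

lemma tendsto_pow_mul_besselAbel_of_lt (α : ℝ) {ν μ : ℝ} (hν : ν < -1)
    (hνμ : -1 < ν + μ) (j : ℕ) :
    Tendsto (fun c => c ^ j * besselAbel α (ν + j * α) μ c) (nhdsWithin 0 (Set.Ioi 0))
      (nhds (if j = 0 then besselMoment ν μ else 0)) := by
  set F : ℝ → ℝ → ℝ := fun c t =>
    (c * t ^ α) ^ j * Real.exp (-(c * t ^ α)) * (t ^ ν * besselJ μ t) with hF
  have hint := integrableOn_rpow_mul_besselJ hν hνμ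
  have hFeq : ∀ c t : ℝ, 0 < t → F c t =
      c ^ j * (t ^ (ν + j * α) * Real.exp (-(c * t ^ α)) * besselJ μ t) := fun c t ht => by
    simp only [hF]
    rw [Real.rpow_add ht, mul_comm (j : ℝ) α, Real.rpow_mul ht.le, Real.rpow_natCast, mul_pow]
    ring
  have hlim : Tendsto (fun c => ∫ t in Set.Ioi (0 : ℝ), F c t) (nhdsWithin 0 (Set.Ioi 0))
      (nhds (∫ t in Set.Ioi (0 : ℝ), (0 : ℝ) ^ j * (t ^ ν * besselJ μ t))) := by
    refine tendsto_integral_filter_of_dominated_convergence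
      (fun t => j.factorial * |t ^ ν * besselJ μ t|) ?_ ?_ (hint.abs.const_mul _) ?_
    · filter_upwards [self_mem_nhdsWithin] with c hc
      refine AEStronglyMeasurable.congr
        (((continuousOn_rpow_mul_exp_neg (ν + j * α) α c).mul
          (continuousOn_besselJ μ)).const_mul (c ^ j) |>.aestronglyMeasurable measurableSet_Ioi) ?_
      exact (ae_restrict_mem measurableSet_Ioi).mono fun t ht => (hFeq c t ht).symm
    · filter_upwards [self_mem_nhdsWithin] with c (hc : 0 < c)
      refine (ae_restrict_mem measurableSet_Ioi).mono fun t (ht : 0 < t) => ?_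
      simp only [hF]
      rw [Real.norm_eq_abs, abs_mul, abs_of_pos (by positivity)]
      gcongr
      exact pow_mul_exp_neg_le_factorial (by positivity) j
    · refine .of_forall fun t => ?_
      have : Continuous fun c : ℝ => F c t := by simp only [hF]; fun_prop
      have h := this.tendsto 0
      simp only [hF, zero_mul, neg_zero, Real.exp_zero, mul_one] at h
      exact h.mono_left nhdsWithin_le_nhds
  rw [integral_const_mul, integral_rpow_mul_besselJ hν hνμ] at hlim
  have hval : (0 : ℝ) ^ j *
      (2 ^ ν * Real.Gamma ((ν + μ + 1) / 2) / Real.Gamma ((μ + 1 - ν) / 2)) =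
      if j = 0 then besselMoment ν μ else 0 := by
    split_ifs with h
    · simp [h, besselMoment]
    · simp [h]
  rw [hval] at hlim
  refine hlim.congr fun c => ?_
  rw [setIntegral_congr_fun measurableSet_Ioi (hFeq c), integral_const_mul, besselAbel]

lemma tendsto_pow_mul_besselAbel {α : ℝ} (hα : 0 < α) (k : ℕ) :
    ∀ (ν μ : ℝ) (j : ℕ), ν < k - 1 → -1 < ν + μ →
      Tendsto (fun c => c ^ j * besselAbel α (ν + j * α) μ c) (nhdsWithin 0 (Set.Ioi 0))
        (nhds (if j = 0 then besselMoment ν μ else 0)) := by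
  induction k with
  | zero =>
    intro ν μ j hν hνμ
    exact tendsto_pow_mul_besselAbel_of_lt α (by simpa using hν) hνμ j
  | succ k ih =>
    intro ν μ j hν hνμ
    push_cast at hν
    have h1 := ih (ν - 1) (μ + 1) j (by linarith) (by linarith)
    have h2 := ih (ν - 1) (μ + 1) (j + 1) (by linarith) (by linarith)
    have h := (h1.const_mul (μ + 1 - (ν + j * α))).add (h2.const_mul α)
    have hval : (μ + 1 - (ν + j * α)) * (if j = 0 then besselMoment (ν - 1) (μ + 1) else 0) +
        α * (if j + 1 = 0 then besselMoment (ν - 1) (μ + 1) else 0) =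
        if j = 0 then besselMoment ν μ else 0 := by
      split_ifs with h <;> simp_all [besselMoment_eq ν μ]
    rw [hval] at h
    refine h.congr' (eventually_mem_nhdsWithin.mono fun c (hc : 0 < c) => ?_)
    beta_reduce
    have hj : (0 : ℝ) ≤ j * α := by positivity
    rw [besselAbel_eq hα (by linarith : -1 < ν + j * α + μ) hc]
    push_cast
    rw [show ν + j * α - 1 = ν - 1 + j * α by ring,
      show ν - 1 + (j + 1) * α = ν - 1 + j * α + α by ring]
    ring

lemma besselMoment_eq_cos {ν μ : ℝ} (h : -1 < ν - μ) :
    besselMoment ν μ = 2 ^ ν / Real.pi * Real.Gamma ((ν - μ + 1) / 2) *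
      Real.Gamma ((ν + μ + 1) / 2) * Real.cos (Real.pi * (ν - μ) / 2) := by
  have hG : Real.Gamma ((ν - μ + 1) / 2) ≠ 0 := (Real.Gamma_pos_of_pos (by linarith)).ne'
  have hrefl := Real.Gamma_mul_Gamma_one_sub ((ν - μ + 1) / 2)
  rw [show 1 - (ν - μ + 1) / 2 = (μ + 1 - ν) / 2 by ring,
    show Real.pi * ((ν - μ + 1) / 2) = Real.pi * (ν - μ) / 2 + Real.pi / 2 by ring,
    Real.sin_add_pi_div_two] at hrefl
  have hinv : (Real.Gamma ((μ + 1 - ν) / 2))⁻¹ =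
      Real.Gamma ((ν - μ + 1) / 2) * Real.cos (Real.pi * (ν - μ) / 2) / Real.pi := by
    have := congrArg (·⁻¹) hrefl
    simp only [mul_inv, inv_div] at this
    rw [mul_div_assoc, ← this, mul_inv_cancel_left₀ hG]
  rw [besselMoment, div_eq_mul_inv, hinv]
  ring

/-- For real `ν, μ` with `ν > |μ| - 1` and real `α > 0`, the limit as `r → +∞` of
`∫₀^∞ t^ν e^{-(t/r)^α} J_μ(t) dt` exists and equals
`(2^ν/π) Γ((ν-μ+1)/2) Γ((ν+μ+1)/2) cos(π(ν-μ)/2)`. -/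
theorem stmt0 (ν μ α : ℝ) (hν : ν > |μ| - 1) (hα : 0 < α) :
    Tendsto
      (fun r : ℝ => ∫ t in Set.Ioi (0 : ℝ), t ^ ν * Real.exp (-(t / r) ^ α) * besselJ μ t)
      atTop
      (nhds ((2 : ℝ) ^ ν / Real.pi * Real.Gamma ((ν - μ + 1) / 2) *
        Real.Gamma ((ν + μ + 1) / 2) * Real.cos (Real.pi * (ν - μ) / 2))) := by
  obtain ⟨hμ1, hμ2⟩ := abs_lt.mp (show |μ| < ν + 1 by linarith)
  obtain ⟨k, hk⟩ := exists_nat_gt (ν + 1)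
  have h := tendsto_pow_mul_besselAbel hα k ν μ 0 (by linarith) (by linarith)
  simp only [pow_zero, one_mul, Nat.cast_zero, zero_mul, add_zero, if_true] at h
  rw [besselMoment_eq_cos (by linarith)] at h
  have hr : Tendsto (fun r : ℝ => r ^ (-α)) atTop (nhdsWithin 0 (Set.Ioi 0)) :=
    tendsto_nhdsWithin_iff.mpr ⟨tendsto_rpow_neg_atTop hα,
      (eventually_gt_atTop 0).mono fun r hr => Real.rpow_pos_of_pos hr _⟩
  refine (h.comp hr).congr' ((eventually_gt_atTop 0).mono fun r hr => ?_)
  refine setIntegral_congr_fun measurableSet_Ioi fun t (ht : 0 < t) => ?_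
  simp only
  rw [Real.div_rpow ht.le hr.le, Real.rpow_neg hr.le, inv_mul_eq_div]
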